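/- Let S⁰ be an adequate semigroup with semilattice of idempotents E⁰, L a left adequate semigroup and R a right adequate semigroup such that S⁰ is a quasi-ideal adequate transversal of both L and R, and let ∗ : R × L → S⁰ satisfy conditions (1) and (2). Then for all a, b ∈ R and x, y ∈ L: if a∗x = b∗x then a∗e_x = b∗e_x, and if a∗x = a∗y then f_a∗x = f_a∗y. -/

import Mathlib

/-!
Common framework: "relative" semigroup-theoretic notions.  All notions are taken
relative to a carrier set `U` inside an ambient type, together with an explicit
binary operation `mul` (only the values of `mul` on `U` are relevant).  For an
honest semigroup `S` one takes `U = Set.univ` and `mul = mulOf S`.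

* `RStarOn mul U a b` : the relation `a ℛ* b` computed in `U` with an identity
  adjoined (the two clauses correspond to multipliers from `U` and to the
  adjoined identity).
* `LStarOn`, `GreenLOn`, `GreenROn` : dual / Green's relations.
* `AbundantOn`, `AdequateOn`, `LeftAdequateOn`, `RightAdequateOn`.
* `AdequateTransversalOn mul U S0` : `S0` is an adequate `*`-subsemigroup of `U`
  which is an adequate transversal, with the data `bar x = x̄`, `e x = e_x`,
  `f x = f_x`, and `plus s = s⁺`, `star s = s⋆` for `s ∈ S0`.
* `InverseTransversalOn mul U S0` : `S0` is an inverse transversal of the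
  regular semigroup `U`, with `o x = x⁰` the unique inverse of `x` in `S0`.
-/

namespace Paper

universe u

variable {α : Type*} {β : Type*} {γ : Type*}

def mulOf (α : Type*) [Mul α] : α → α → α := fun a b => a * b

/-- `x` is an idempotent for the operation `mul`. -/
def Idem (mul : α → α → α) (x : α) : Prop := mul x x = x

/-- The relation `ℛ*` on `U` (with an identity adjoined to `U`). -/
def RStarOn (mul : α → α → α) (U : Set α) (a b : α) : Prop :=
  (∀ x ∈ U, ∀ y ∈ U, (mul x a = mul y a ↔ mul x b = mul y b)) ∧
  (∀ x ∈ U, (mul x a = a ↔ mul x b = b))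

/-- The relation `ℒ*` on `U` (with an identity adjoined to `U`). -/
def LStarOn (mul : α → α → α) (U : Set α) (a b : α) : Prop :=
  (∀ x ∈ U, ∀ y ∈ U, (mul a x = mul a y ↔ mul b x = mul b y)) ∧
  (∀ x ∈ U, (mul a x = a ↔ mul b x = b))

/-- Green's relation `ℒ` on `U`: `U¹ a = U¹ b`. -/
def GreenLOn (mul : α → α → α) (U : Set α) (a b : α) : Prop :=
  (a = b ∨ ∃ u ∈ U, mul u b = a) ∧ (b = a ∨ ∃ v ∈ U, mul v a = b)

/-- Green's relation `ℛ` on `U`: `a U¹ = b U¹`. -/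
def GreenROn (mul : α → α → α) (U : Set α) (a b : α) : Prop :=
  (a = b ∨ ∃ u ∈ U, mul b u = a) ∧ (b = a ∨ ∃ v ∈ U, mul a v = b)

/-- `U` is closed under `mul`. -/
def ClosedOn (mul : α → α → α) (U : Set α) : Prop :=
  ∀ a ∈ U, ∀ b ∈ U, mul a b ∈ U

/-- `U` with the operation `mul` is a semigroup. -/
def SemigroupOn (mul : α → α → α) (U : Set α) : Prop :=
  ClosedOn mul U ∧ ∀ a ∈ U, ∀ b ∈ U, ∀ c ∈ U, mul (mul a b) c = mul a (mul b c)

/-- Every `ℛ*`-class and every `ℒ*`-class of `U` contains an idempotent. -/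
def AbundantOn (mul : α → α → α) (U : Set α) : Prop :=
  ∀ a ∈ U, (∃ e ∈ U, Idem mul e ∧ RStarOn mul U a e) ∧
           (∃ f ∈ U, Idem mul f ∧ LStarOn mul U a f)

/-- Abundant with commuting idempotents. -/
def AdequateOn (mul : α → α → α) (U : Set α) : Prop :=
  AbundantOn mul U ∧
    ∀ u ∈ U, ∀ v ∈ U, Idem mul u → Idem mul v → mul u v = mul v u

/-- Abundant, and every `ℛ*`-class contains a unique idempotent. -/
def LeftAdequateOn (mul : α → α → α) (U : Set α) : Prop :=
  AbundantOn mul U ∧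
    ∀ u ∈ U, ∀ v ∈ U, Idem mul u → Idem mul v → RStarOn mul U u v → u = v

/-- Abundant, and every `ℒ*`-class contains a unique idempotent. -/
def RightAdequateOn (mul : α → α → α) (U : Set α) : Prop :=
  AbundantOn mul U ∧
    ∀ u ∈ U, ∀ v ∈ U, Idem mul u → Idem mul v → LStarOn mul U u v → u = v

/-- `S0` is a quasi-ideal of `U` : `S0 U S0 ⊆ S0`. -/
def QuasiIdealOn (mul : α → α → α) (U S0 : Set α) : Prop :=
  ∀ s ∈ S0, ∀ x ∈ U, ∀ t ∈ S0, mul (mul s x) t ∈ S0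

/-- Every element of `U` has an inverse in `U`. -/
def RegularOn (mul : α → α → α) (U : Set α) : Prop :=
  ∀ x ∈ U, ∃ u ∈ U, mul (mul x u) x = x ∧ mul (mul u x) u = u

/-- Regular with commuting idempotents, i.e. an inverse semigroup. -/
def InverseSgpOn (mul : α → α → α) (U : Set α) : Prop :=
  RegularOn mul U ∧
    ∀ u ∈ U, ∀ v ∈ U, Idem mul u → Idem mul v → mul u v = mul v u

/-- Regular, and every Green `ℛ`-class contains a unique idempotent. -/
def LeftInverseSgpOn (mul : α → α → α) (U : Set α) : Prop :=
  RegularOn mul U ∧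
    ∀ u ∈ U, ∀ v ∈ U, Idem mul u → Idem mul v → GreenROn mul U u v → u = v

/-- Regular, and every Green `ℒ`-class contains a unique idempotent. -/
def RightInverseSgpOn (mul : α → α → α) (U : Set α) : Prop :=
  RegularOn mul U ∧
    ∀ u ∈ U, ∀ v ∈ U, Idem mul u → Idem mul v → GreenLOn mul U u v → u = v

/-- An isomorphism from `(A, mulA)` onto `(B, mulB)`. -/
def IsoOn (mulA : α → α → α) (mulB : β → β → β) (A : Set α) (B : Set β) : Prop :=
  ∃ θ : α → β, Set.BijOn θ A B ∧ ∀ a ∈ A, ∀ b ∈ A, θ (mulA a b) = mulB (θ a) (θ b)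

/-- `S0` is an adequate transversal of the abundant semigroup `U`.  `S0` is an
adequate `*`-subsemigroup of `U` (witnessed by `plus`/`star`, the canonical
idempotents `a⁺ ℛ* a`, `a⋆ ℒ* a` of elements of `S0`, the `ℛ*`/`ℒ*` relations
being those of the big semigroup `U`, which gives the `*`-subsemigroup property),
and every `x ∈ U` factors uniquely as `x = e_x x̄ f_x` with `x̄ ∈ S0`,
`e_x, f_x` idempotents of `U`, `e_x ℒ x̄⁺` and `f_x ℛ x̄⋆`. -/
structure AdequateTransversalOn (mul : α → α → α) (U S0 : Set α) where
  sub : S0 ⊆ U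
  mul_mem : ∀ a ∈ S0, ∀ b ∈ S0, mul a b ∈ S0
  bar : α → α
  e : α → α
  f : α → α
  plus : α → α
  star : α → α
  plus_mem : ∀ a ∈ S0, plus a ∈ S0
  plus_idem : ∀ a ∈ S0, Idem mul (plus a)
  plus_rstar : ∀ a ∈ S0, RStarOn mul U a (plus a)
  star_mem : ∀ a ∈ S0, star a ∈ S0
  star_idem : ∀ a ∈ S0, Idem mul (star a)
  star_lstar : ∀ a ∈ S0, LStarOn mul U a (star a)
  idem_comm : ∀ u ∈ S0, ∀ v ∈ S0, Idem mul u → Idem mul v → mul u v = mul v u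
  bar_mem : ∀ x ∈ U, bar x ∈ S0
  e_mem : ∀ x ∈ U, e x ∈ U
  f_mem : ∀ x ∈ U, f x ∈ U
  e_idem : ∀ x ∈ U, Idem mul (e x)
  f_idem : ∀ x ∈ U, Idem mul (f x)
  decomp : ∀ x ∈ U, x = mul (mul (e x) (bar x)) (f x)
  e_greenL : ∀ x ∈ U, GreenLOn mul U (e x) (plus (bar x))
  f_greenR : ∀ x ∈ U, GreenROn mul U (f x) (star (bar x))
  unique : ∀ x ∈ U, ∀ s ∈ S0, ∀ e' ∈ U, ∀ f' ∈ U, Idem mul e' → Idem mul f' →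
      x = mul (mul e' s) f' → GreenLOn mul U e' (plus s) → GreenROn mul U f' (star s) →
      s = bar x ∧ e' = e x ∧ f' = f x

namespace AdequateTransversalOn

variable {mul : α → α → α} {U S0 : Set α}

/-- `R = {x ∈ U : e_x = e_{x̄}}`. -/
def Rset (T : AdequateTransversalOn mul U S0) : Set α :=
  {x | x ∈ U ∧ T.e x = T.e (T.bar x)}

/-- `L = {x ∈ U : f_x = f_{x̄}}`. -/
def Lset (T : AdequateTransversalOn mul U S0) : Set α :=
  {x | x ∈ U ∧ T.f x = T.f (T.bar x)}

/-- `I = {e_x : x ∈ U}`. -/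
def Iset (T : AdequateTransversalOn mul U S0) : Set α :=
  {y | ∃ x ∈ U, T.e x = y}

/-- `Λ = {f_x : x ∈ U}`. -/
def LamSet (T : AdequateTransversalOn mul U S0) : Set α :=
  {y | ∃ x ∈ U, T.f x = y}

/-- The transversal is multiplicative: `Λ I ⊆ E⁰`. -/
def IsMultiplicative (T : AdequateTransversalOn mul U S0) : Prop :=
  ∀ l ∈ T.LamSet, ∀ i ∈ T.Iset, mul l i ∈ S0 ∧ Idem mul (mul l i)

end AdequateTransversalOn

/-- The spined product set `T = L |×| R ⊆ S × S` attached to an adequate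
transversal of `S` (ambient carrier `U`). -/
def spSet {mul : α → α → α} {U S0 : Set α}
    (T : AdequateTransversalOn mul U S0) : Set (α × α) :=
  {p | p.1 ∈ T.Lset ∧ p.2 ∈ T.Rset ∧ T.bar p.1 = T.bar p.2}

/-- The multiplication `(x,a)(y,b) = (e_x(ay), (ay) f_b)` on the spined product. -/
def spMul {mul : α → α → α} {U S0 : Set α}
    (T : AdequateTransversalOn mul U S0) : α × α → α × α → α × α :=
  fun p q => (mul (T.e p.1) (mul p.2 q.1), mul (mul p.2 q.1) (T.f q.2))

/-- The map `φ : S → T`, `x ↦ (e_x x̄, x̄ f_x)`. -/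
def phiMap {mul : α → α → α} {U S0 : Set α}
    (T : AdequateTransversalOn mul U S0) : α → α × α :=
  fun x => (mul (T.e x) (T.bar x), mul (T.bar x) (T.f x))

/-- `T⁰ = {(s,s) : s ∈ S0}`. -/
def diagSet (S0 : Set α) : Set (α × α) := {p | ∃ s ∈ S0, p = (s, s)}

/-- Abstract spined product `L |×| R` over a common transversal `S⁰` (a type `γ`
embedded into `L` and `R` by `jL`, `jR`). -/
def absTset {mulL : α → α → α} {mulR : β → β → β} {jL : γ → α} {jR : γ → β}
    (TL : AdequateTransversalOn mulL Set.univ (Set.range jL))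
    (TR : AdequateTransversalOn mulR Set.univ (Set.range jR)) : Set (α × β) :=
  {p | ∃ s : γ, jL s = TL.bar p.1 ∧ jR s = TR.bar p.2}

/-- The multiplication `(x,a)(y,b) = (e_x(a∗y), (a∗y) f_b)`. -/
def absMul {mulL : α → α → α} {mulR : β → β → β} {jL : γ → α} {jR : γ → β}
    (TL : AdequateTransversalOn mulL Set.univ (Set.range jL))
    (TR : AdequateTransversalOn mulR Set.univ (Set.range jR))
    (st : β → α → γ) : α × β → α × β → α × β :=
  fun p q => (mulL (TL.e p.1) (jL (st p.2 q.1)), mulR (jR (st p.2 q.1)) (TR.f q.2))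

/-- `T⁰ = {(s,s) : s ∈ S⁰}` inside `L × R`, where `s` is viewed in `L` and in `R`. -/
def absT0 (jL : γ → α) (jR : γ → β) : Set (α × β) :=
  {p | ∃ s : γ, p = (jL s, jR s)}

/-- `S0` is an inverse transversal of the regular semigroup `U`: an inverse
subsemigroup meeting the set of inverses of each `x ∈ U` in exactly one
element `o x = x⁰`. -/
structure InverseTransversalOn (mul : α → α → α) (U S0 : Set α) where
  sub : S0 ⊆ U
  mul_mem : ∀ a ∈ S0, ∀ b ∈ S0, mul a b ∈ S0
  o : α → α
  o_mem : ∀ x ∈ U, o x ∈ S0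
  o_inv1 : ∀ x ∈ U, mul (mul x (o x)) x = x
  o_inv2 : ∀ x ∈ U, mul (mul (o x) x) (o x) = o x
  o_unique : ∀ x ∈ U, ∀ u ∈ S0, mul (mul x u) x = x → mul (mul u x) u = u → u = o x
  idem_comm : ∀ u ∈ S0, ∀ v ∈ S0, Idem mul u → Idem mul v → mul u v = mul v u

namespace InverseTransversalOn

variable {mul : α → α → α} {U S0 : Set α}

/-- `L = {x ∈ U : x⁰x ∈ E⁰}`. -/
def LsetI (T : InverseTransversalOn mul U S0) : Set α :=
  {x | x ∈ U ∧ mul (T.o x) x ∈ S0 ∧ Idem mul (mul (T.o x) x)}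

/-- `R = {x ∈ U : xx⁰ ∈ E⁰}`. -/
def RsetI (T : InverseTransversalOn mul U S0) : Set α :=
  {x | x ∈ U ∧ mul x (T.o x) ∈ S0 ∧ Idem mul (mul x (T.o x))}

end InverseTransversalOn

/-- Spined product set for an inverse transversal: `{(x,a) : x⁰ = a⁰}`. -/
def invSpSet {mul : α → α → α} {U S0 : Set α}
    (T : InverseTransversalOn mul U S0) : Set (α × α) :=
  {p | p.1 ∈ T.LsetI ∧ p.2 ∈ T.RsetI ∧ T.o p.1 = T.o p.2}

/-- The multiplication `(x,a)(y,b) = ((xx⁰)(ay), (ay)(b⁰b))`. -/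
def invSpMul {mul : α → α → α} {U S0 : Set α}
    (T : InverseTransversalOn mul U S0) : α × α → α × α → α × α :=
  fun p q => (mul (mul p.1 (T.o p.1)) (mul p.2 q.1),
              mul (mul p.2 q.1) (mul (T.o q.2) q.2))

/-- Abstract spined product for inverse transversals: `{(x,a) : x⁰ = a⁰}`. -/
def invAbsTset {mulL : α → α → α} {mulR : β → β → β} {jL : γ → α} {jR : γ → β}
    (TL : InverseTransversalOn mulL Set.univ (Set.range jL))
    (TR : InverseTransversalOn mulR Set.univ (Set.range jR)) : Set (α × β) :=
  {p | ∃ s : γ, jL s = TL.o p.1 ∧ jR s = TR.o p.2}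

/-- The multiplication `(x,a)(y,b) = ((xx⁰)(a∗y), (a∗y)(b⁰b))`. -/
def invAbsMul {mulL : α → α → α} {mulR : β → β → β} {jL : γ → α} {jR : γ → β}
    (TL : InverseTransversalOn mulL Set.univ (Set.range jL))
    (TR : InverseTransversalOn mulR Set.univ (Set.range jR))
    (st : β → α → γ) : α × β → α × β → α × β :=
  fun p q => (mulL (mulL p.1 (TL.o p.1)) (jL (st p.2 q.1)),
              mulR (jR (st p.2 q.1)) (mulR (TR.o q.2) q.2))

/-- The multiplication `(e,x)(g,w) = (e(aa⁻¹), a)`, `a = x((x⁻¹x)g)w`, on `I × S⁰`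
(Chen-style construction from a left normal band `I` with semilattice transversal
`E⁰ = E(S⁰)`; `σ` embeds idempotents of the inverse semigroup `γ` into the band
`β`, and `π : β → γ` is the semilattice-transversal map `e ↦ e⁰`). -/
def bandMul (mulB : β → β → β) (mulG : γ → γ → γ) (σ : γ → β) (π : β → γ)
    (inv : γ → γ) (p q : β × γ) : β × γ :=
  let a := mulG (mulG p.2 (π (mulB (σ (mulG (inv p.2) p.2)) q.1))) q.2
  (mulB p.1 (σ (mulG a (inv a))), a)

/-- `T = {(e,x) : e⁰ = xx⁻¹}`. -/
def bandTset (mulG : γ → γ → γ) (π : β → γ) (inv : γ → γ) : Set (β × γ) :=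
  {p | π p.1 = mulG p.2 (inv p.2)}

/-- `T⁰ = {(aa⁻¹, a) : a ∈ S⁰}` (with `aa⁻¹` viewed in the band via `σ`). -/
def bandT0 (mulG : γ → γ → γ) (σ : γ → β) (inv : γ → γ) : Set (β × γ) :=
  {p | ∃ s : γ, p = (σ (mulG s (inv s)), s)}

end Paper

namespace Paper

variable {S : Type*} [Semigroup S] {S0 : Set S}

theorem mul_eq_left_of_greenL {a p : S} (hp : p * p = p)
    (h : GreenLOn (mulOf S) Set.univ a p) : a * p = a := by
  rcases h.1 with rfl | ⟨u, -, hu⟩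
  · exact hp
  · change u * p = a at hu
    rw [← hu, mul_assoc, hp]

theorem mul_eq_right_of_greenR {a p : S} (hp : p * p = p)
    (h : GreenROn (mulOf S) Set.univ a p) : p * a = a := by
  rcases h.1 with rfl | ⟨u, -, hu⟩
  · exact hp
  · change p * u = a at hu
    rw [← hu, ← mul_assoc, hp]

theorem rStar_of_greenR {a b : S} (h : GreenROn (mulOf S) Set.univ a b) :
    RStarOn (mulOf S) Set.univ a b := by
  obtain ⟨h1 | ⟨u, -, hu⟩, h2⟩ := h
  · subst h1
    exact ⟨fun _ _ _ _ => Iff.rfl, fun _ _ => Iff.rfl⟩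
  obtain h2 | ⟨v, -, hv⟩ := h2
  · subst h2
    exact ⟨fun _ _ _ _ => Iff.rfl, fun _ _ => Iff.rfl⟩
  simp only [mulOf] at hu hv
  refine ⟨fun x _ y _ => ⟨fun h => ?_, fun h => ?_⟩, fun x _ => ⟨fun h => ?_, fun h => ?_⟩⟩ <;>
    simp only [mulOf] at h ⊢
  · rw [← hv, ← mul_assoc, h, mul_assoc]
  · rw [← hu, ← mul_assoc, h, mul_assoc]
  · rw [← hv, ← mul_assoc, h]
  · rw [← hu, ← mul_assoc, h]

theorem lStar_of_greenL {a b : S} (h : GreenLOn (mulOf S) Set.univ a b) :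
    LStarOn (mulOf S) Set.univ a b := by
  obtain ⟨h1 | ⟨u, -, hu⟩, h2⟩ := h
  · subst h1
    exact ⟨fun _ _ _ _ => Iff.rfl, fun _ _ => Iff.rfl⟩
  obtain h2 | ⟨v, -, hv⟩ := h2
  · subst h2
    exact ⟨fun _ _ _ _ => Iff.rfl, fun _ _ => Iff.rfl⟩
  simp only [mulOf] at hu hv
  refine ⟨fun x _ y _ => ⟨fun h => ?_, fun h => ?_⟩, fun x _ => ⟨fun h => ?_, fun h => ?_⟩⟩ <;>
    simp only [mulOf] at h ⊢
  · rw [← hv, mul_assoc, h, ← mul_assoc]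
  · rw [← hu, mul_assoc, h, ← mul_assoc]
  · rw [← hv, mul_assoc, h]
  · rw [← hu, mul_assoc, h]

namespace AdequateTransversalOn

variable (T : AdequateTransversalOn (mulOf S) Set.univ S0)

theorem plus_mul {s : S} (hs : s ∈ S0) : T.plus s * s = s :=
  ((T.plus_rstar s hs).2 _ trivial).2 (T.plus_idem s hs)

theorem mul_star {s : S} (hs : s ∈ S0) : s * T.star s = s :=
  ((T.star_lstar s hs).2 _ trivial).2 (T.star_idem s hs)

theorem plus_eq_self {p : S} (hp : p ∈ S0) (hpp : p * p = p) : T.plus p = p :=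
  calc T.plus p = p * T.plus p := (((T.plus_rstar p hp).2 p trivial).1 hpp).symm
    _ = T.plus p * p := T.idem_comm _ hp _ (T.plus_mem p hp) hpp (T.plus_idem p hp)
    _ = p := T.plus_mul hp

theorem star_eq_self {p : S} (hp : p ∈ S0) (hpp : p * p = p) : T.star p = p :=
  calc T.star p = T.star p * p := (((T.star_lstar p hp).2 p trivial).1 hpp).symm
    _ = p * T.star p := T.idem_comm _ (T.star_mem p hp) _ hp (T.star_idem p hp) hpp
    _ = p := T.mul_star hp

/-- An idempotent `i` of `S` that is `ℒ`-related to an idempotent `p` of the transversal has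
`ī = p`, `e_i = i` and `f_i = p`. -/
theorem of_greenL {i p : S} (hp : p ∈ S0) (hpp : p * p = p) (hi : i * i = i)
    (h : GreenLOn (mulOf S) Set.univ i p) : p = T.bar i ∧ i = T.e i ∧ p = T.f i := by
  refine T.unique i trivial p hp i trivial p trivial hi hpp ?_ ?_ ?_
  · simp only [mulOf, mul_eq_left_of_greenL hpp h]
  · rwa [T.plus_eq_self hp hpp]
  · rw [T.star_eq_self hp hpp]
    exact ⟨Or.inl rfl, Or.inl rfl⟩

/-- An idempotent `i` of `S` that is `ℛ`-related to an idempotent `p` of the transversal has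
`ī = p`, `e_i = p` and `f_i = i`. -/
theorem of_greenR {i p : S} (hp : p ∈ S0) (hpp : p * p = p) (hi : i * i = i)
    (h : GreenROn (mulOf S) Set.univ i p) : p = T.bar i ∧ p = T.e i ∧ i = T.f i := by
  refine T.unique i trivial p hp p trivial i trivial hpp hi ?_ ?_ ?_
  · simp only [mulOf, hpp, mul_eq_right_of_greenR hpp h]
  · rw [T.plus_eq_self hp hpp]
    exact ⟨Or.inl rfl, Or.inl rfl⟩
  · rwa [T.star_eq_self hp hpp]

theorem e_mul_bar (hS : LeftAdequateOn (mulOf S) Set.univ) (x : S) : T.e x * T.bar x = x := by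
  have hf : T.f x = T.star (T.bar x) :=
    hS.2 _ trivial _ trivial (T.f_idem x trivial) (T.star_idem _ (T.bar_mem x trivial))
      (rStar_of_greenR (T.f_greenR x trivial))
  have h : x = T.e x * T.bar x * T.f x := T.decomp x trivial
  rw [hf, mul_assoc, T.mul_star (T.bar_mem x trivial)] at h
  exact h.symm

theorem bar_mul_f (hS : RightAdequateOn (mulOf S) Set.univ) (x : S) : T.bar x * T.f x = x := by
  have he : T.e x = T.plus (T.bar x) :=
    hS.2 _ trivial _ trivial (T.e_idem x trivial) (T.plus_idem _ (T.bar_mem x trivial))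
      (lStar_of_greenL (T.e_greenL x trivial))
  have h : x = T.e x * T.bar x * T.f x := T.decomp x trivial
  rw [he, T.plus_mul (T.bar_mem x trivial)] at h
  exact h.symm

end AdequateTransversalOn

end Paper

open Paper in
/-- **Lemma `property3`.** For all `a, b ∈ R`, `x, y ∈ L`: if
`a∗x = b∗x` then `a∗e_x = b∗e_x`, and if `a∗x = a∗y` then `f_a∗x = f_a∗y`. -/
theorem stmt9 {L R G : Type u} [Semigroup L] [Semigroup R] [Semigroup G]
    (jL : G → L) (jR : G → R)
    (hjL : Function.Injective jL) (hjR : Function.Injective jR)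
    (hjLm : ∀ s t : G, jL (s * t) = jL s * jL t)
    (hjRm : ∀ s t : G, jR (s * t) = jR s * jR t)
    (hG : AdequateOn (mulOf G) Set.univ)
    (hL : LeftAdequateOn (mulOf L) Set.univ)
    (hR : RightAdequateOn (mulOf R) Set.univ)
    (TL : AdequateTransversalOn (mulOf L) Set.univ (Set.range jL))
    (TR : AdequateTransversalOn (mulOf R) Set.univ (Set.range jR))
    (hQL : QuasiIdealOn (mulOf L) Set.univ (Set.range jL))
    (hQR : QuasiIdealOn (mulOf R) Set.univ (Set.range jR))
    (st : R → L → G)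
    (cond1 : ∀ (y z : L) (a b : R),
      (∃ s : G, jL s = TL.bar y ∧ jR s = TR.bar b) →
      st (jR (st a y) * TR.f b) z = st a (TL.e y * jL (st b z)))
    (cond2L : ∀ (s : G) (x : L), jL (st (jR s) x) = jL s * x)
    (cond2R : ∀ (a : R) (s : G), jR (st a (jL s)) = a * jR s)
    :
    ∀ (a b : R) (x y : L),
      (st a x = st b x → st a (TL.e x) = st b (TL.e x)) ∧
      (st a x = st a y → st (TR.f a) x = st (TR.f a) y) := by
  have idemL : ∀ {p : G}, jL p * jL p = jL p → p * p = p := fun h => hjL (by rw [hjLm, h])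
  have idemR : ∀ {p : G}, jR p * jR p = jR p → p * p = p := fun h => hjR (by rw [hjRm, h])
  have refl_R : ∀ p : R, GreenLOn (mulOf R) Set.univ p p := fun _ => ⟨Or.inl rfl, Or.inl rfl⟩
  have refl_L : ∀ p : L, GreenLOn (mulOf L) Set.univ p p := fun _ => ⟨Or.inl rfl, Or.inl rfl⟩
  intro a b x y
  constructor
  · intro h
    obtain ⟨s, hs⟩ := TL.bar_mem x trivial
    obtain ⟨p, hp⟩ := TL.plus_mem _ (TL.bar_mem x trivial)
    have hpL : jL p * jL p = jL p := by
      rw [hp]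
      exact TL.plus_idem _ (TL.bar_mem x trivial)
    have hpR : jR p * jR p = jR p := by rw [← hjRm, idemL hpL]
    have hEL : GreenLOn (mulOf L) Set.univ (TL.e x) (jL p) := hp ▸ TL.e_greenL x trivial
    obtain ⟨hbar, he, -⟩ := TL.of_greenL ⟨p, rfl⟩ hpL (TL.e_idem x trivial) hEL
    obtain ⟨hbar', -, hf⟩ := TR.of_greenL ⟨p, rfl⟩ hpR hpR (refl_R _)
    have key : ∀ (c : R) (t : G), st c (TL.e x) * (p * t) = st c (TL.e x * jL (p * t)) := by
      intro c t
      have h1 := cond1 (TL.e x) (jL t) c (jR p) ⟨p, hbar, hbar'⟩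
      have h2 : st (jR p) (jL t) = p * t := hjR (by rw [cond2R, hjRm])
      rw [h2, ← he, ← hf, ← hjRm] at h1
      rw [← h1]
      apply hjR
      rw [cond2R, ← hjRm, mul_assoc]
    have hps : p * s = s := hjL (by
      rw [hjLm, hp, hs]
      exact TL.plus_mul (TL.bar_mem x trivial))
    have key_x : ∀ c : R, st c (TL.e x) * s = st c x := by
      intro c
      have := key c s
      rwa [hps, hs, TL.e_mul_bar hL] at this
    have key_p : ∀ c : R, st c (TL.e x) * p = st c (TL.e x) := by
      intro c
      have := key c p
      rwa [idemL hpL, mul_eq_left_of_greenL hpL hEL] at this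
    have hx : mulOf L (jL (st a (TL.e x))) (TL.bar x) =
        mulOf L (jL (st b (TL.e x))) (TL.bar x) := by
      simp only [mulOf, ← hs, ← hjLm, key_x, h]
    have := ((TL.plus_rstar _ (TL.bar_mem x trivial)).1 _ trivial _ trivial).1 hx
    simp only [mulOf, ← hp, ← hjLm, key_p] at this
    exact hjL this
  · intro h
    obtain ⟨s, hs⟩ := TR.bar_mem a trivial
    obtain ⟨q, hq⟩ := TR.star_mem _ (TR.bar_mem a trivial)
    have hqR : jR q * jR q = jR q := by
      rw [hq]
      exact TR.star_idem _ (TR.bar_mem a trivial)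
    have hqL : jL q * jL q = jL q := by rw [← hjLm, idemR hqR]
    have hFR : GreenROn (mulOf R) Set.univ (TR.f a) (jR q) := hq ▸ TR.f_greenR a trivial
    obtain ⟨hbar, -, hf⟩ := TR.of_greenR ⟨q, rfl⟩ hqR (TR.f_idem a trivial) hFR
    obtain ⟨hbar', he, -⟩ := TL.of_greenL ⟨q, rfl⟩ hqL hqL (refl_L _)
    have key : ∀ (t : G) (z : L), st (jR (t * q) * TR.f a) z = t * q * st (TR.f a) z := by
      intro t z
      have h1 := cond1 (jL q) z (jR t) (TR.f a) ⟨q, hbar', hbar⟩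
      have h2 : st (jR t) (jL q) = t * q := hjR (by rw [cond2R, hjRm])
      rw [h2, ← he, ← hf] at h1
      rw [h1]
      apply hjL
      rw [cond2L, hjLm, hjLm, mul_assoc]
    have hsq : s * q = s := hjR (by
      rw [hjRm, hq, hs]
      exact TR.mul_star (TR.bar_mem a trivial))
    have key_a : ∀ z : L, s * st (TR.f a) z = st a z := by
      intro z
      have := key s z
      rw [hsq, hs, TR.bar_mul_f hR] at this
      exact this.symm
    have key_q : ∀ z : L, q * st (TR.f a) z = st (TR.f a) z := by
      intro z
      have := key q z
      rw [idemR hqR, mul_eq_right_of_greenR hqR hFR] at this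
      exact this.symm
    have hx : mulOf R (TR.bar a) (jR (st (TR.f a) x)) =
        mulOf R (TR.bar a) (jR (st (TR.f a) y)) := by
      simp only [mulOf, ← hs, ← hjRm, key_a, h]
    have := ((TR.star_lstar _ (TR.bar_mem a trivial)).1 _ trivial _ trivial).1 hx
    simp only [mulOf, ← hq, ← hjRm, key_q] at this
    exact hjR this
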